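/- Let θ_A, θ_B, θ_C, θ'_A, θ'_B, θ'_C ∈ (0,π) and define, for each triple, the UPB with members |S_1⟩ = |0⟩⊗|0⟩⊗|0⟩, |S_2⟩ = |1⟩⊗|B⟩⊗|C⟩, |S_3⟩ = |A⟩⊗|1⟩⊗|C^⊥⟩, |S_4⟩ = |A^⊥⟩⊗|B^⊥⟩⊗|1⟩, where |A⟩ = cos(θ_A/2)|0⟩ + sin(θ_A/2)|1⟩ and similarly for |B⟩, |C⟩ (and primed versions with the primed angles), with |A^⊥⟩, |B^⊥⟩, |C^⊥⟩ orthogonal unit vectors. If the UPB for (θ_A,θ_B,θ_C) is equivalent (via local unitaries and a permutation of members) to the UPB for (θ'_A,θ'_B,θ'_C), then (θ_A,θ_B,θ_C) = (θ'_A,θ'_B,θ'_C). -/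

import Mathlib

noncomputable section

open Matrix Finset
open scoped ComplexOrder

/-- one-qubit vectors -/
abbrev V2 := Fin 2 → ℂ
/-- index set of the three-qubit space ℂ²⊗ℂ²⊗ℂ² -/
abbrev I8 := Fin 2 × Fin 2 × Fin 2
/-- three-qubit vectors -/
abbrev V8 := I8 → ℂ
/-- one-qubit operators -/
abbrev M2 := Matrix (Fin 2) (Fin 2) ℂ
/-- three-qubit operators -/
abbrev M8 := Matrix I8 I8 ℂ

/-- inner product on ℂ², conjugate-linear in the first argument -/
def inner2 (u v : V2) : ℂ := ∑ i, star (u i) * v i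

/-- inner product on ℂ²⊗ℂ²⊗ℂ², conjugate-linear in the first argument -/
def inner8 (u v : V8) : ℂ := ∑ p, star (u p) * v p

/-- tensor product |a⟩⊗|b⟩⊗|c⟩ of three one-qubit vectors -/
def tp3 (a b c : V2) : V8 := fun p => a p.1 * b p.2.1 * c p.2.2

/-- Kronecker (tensor) product X_A⊗X_B⊗X_C of three one-qubit operators -/
def kron3 (X Y Z : M2) : M8 :=
  Matrix.of fun p q => X p.1 q.1 * Y p.2.1 q.2.1 * Z p.2.2 q.2.2

/-- a product operator on three qubits -/
def IsProductOp (X : M8) : Prop := ∃ XA XB XC : M2, X = kron3 XA XB XC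

/-- the projector |v⟩⟨v| onto a vector -/
def proj8 (v : V8) : M8 := Matrix.vecMulVec v (star v)

/-- A three-qubit unextendible product basis with `n` members: mutually orthonormal
product vectors (products of unit vectors) such that the orthogonal complement of
their span contains no nonzero product vector. -/
structure UPB (n : ℕ) where
  S : Fin n → V8
  prod : ∀ j, ∃ a b c : V2,
    inner2 a a = 1 ∧ inner2 b b = 1 ∧ inner2 c c = 1 ∧ S j = tp3 a b c
  ortho : ∀ i j, inner8 (S i) (S j) = if i = j then 1 else 0
  unext : ∀ a b c : V2, (∀ j, inner8 (S j) (tp3 a b c) = 0) → tp3 a b c = 0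

/-- the bound entangled state ρ_S = (1/(8-n))(I - Σ_j |S_j⟩⟨S_j|) associated with a UPB -/
def upbState {n : ℕ} (U : UPB n) : M8 :=
  ((8 : ℂ) - (n : ℂ))⁻¹ • ((1 : M8) - ∑ j, proj8 (U.S j))

/-- equivalence of four-member UPBs: related by local unitaries and a permutation of members -/
def UPB.Equiv (S T : UPB 4) : Prop :=
  ∃ UA UB UC : M2, UA ∈ Matrix.unitaryGroup (Fin 2) ℂ ∧
    UB ∈ Matrix.unitaryGroup (Fin 2) ℂ ∧ UC ∈ Matrix.unitaryGroup (Fin 2) ℂ ∧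
    ∃ σ : Equiv.Perm (Fin 4), ∀ j, S.S j = (kron3 UA UB UC).mulVec (T.S (σ j))

/-- the positive semidefinite square root of a positive semidefinite matrix
(the former Mathlib definition, since removed) -/
def Matrix.PosSemidef.sqrt {m : Type*} [Fintype m] [DecidableEq m] {A : Matrix m m ℂ}
    (hA : A.PosSemidef) : Matrix m m ℂ :=
  (hA.1.eigenvectorUnitary : Matrix m m ℂ) *
    Matrix.diagonal ((fun x : ℝ => (x : ℂ)) ∘ Real.sqrt ∘ hA.1.eigenvalues) *
    (star hA.1.eigenvectorUnitary : Matrix m m ℂ)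

/-- square root of a positive semidefinite matrix (junk value 0 otherwise) -/
def msqrt {m : Type*} [Fintype m] [DecidableEq m] (A : Matrix m m ℂ) : Matrix m m ℂ :=
  open scoped Classical in if h : A.PosSemidef then h.sqrt else 0

/-- fidelity F(ρ,σ) = tr √(√ρ σ √ρ) of positive semidefinite matrices -/
def fidelity {m : Type*} [Fintype m] [DecidableEq m] (ρ σ : Matrix m m ℂ) : ℝ :=
  ((msqrt (msqrt ρ * σ * msqrt ρ)).trace).re

/-- standard basis vector |0⟩ of ℂ² -/
def e0 : V2 := ![1, 0]
/-- standard basis vector |1⟩ of ℂ² -/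
def e1 : V2 := ![0, 1]
/-- the unit vector cos(θ/2)|0⟩ + sin(θ/2)|1⟩ -/
def vθ (θ : ℝ) : V2 := ![((Real.cos (θ / 2) : ℝ) : ℂ), ((Real.sin (θ / 2) : ℝ) : ℂ)]

/-- equivalence of two four-member families of three-qubit vectors:
related by local unitaries and a permutation of members -/
def FamEquiv (S S' : Fin 4 → V8) : Prop :=
  ∃ UA UB UC : M2, UA ∈ Matrix.unitaryGroup (Fin 2) ℂ ∧
    UB ∈ Matrix.unitaryGroup (Fin 2) ℂ ∧ UC ∈ Matrix.unitaryGroup (Fin 2) ℂ ∧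
    ∃ σ : Equiv.Perm (Fin 4), ∀ j, S j = (kron3 UA UB UC).mulVec (S' (σ j))

/-- the transition probability `|⟨u|v⟩|²` of two one-qubit vectors -/
def transProb (u v : V2) : ℂ := inner2 u v * inner2 v u

theorem kron3_mulVec_tp3 (X Y Z : M2) (a b c : V2) :
    (kron3 X Y Z).mulVec (tp3 a b c) = tp3 (X.mulVec a) (Y.mulVec b) (Z.mulVec c) := by
  ext ⟨i, j, k⟩
  simp only [Matrix.mulVec, dotProduct, kron3, tp3, Matrix.of_apply, Fintype.sum_prod_type,
    Fin.sum_univ_two]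
  ring

theorem inner2_unitary_mulVec {U : M2} (hU : U ∈ Matrix.unitaryGroup (Fin 2) ℂ) (u v : V2) :
    inner2 (U.mulVec u) (U.mulVec v) = inner2 u v := by
  have h (u v : V2) : inner2 u v = star u ⬝ᵥ v := rfl
  rw [h, h, Matrix.star_mulVec, Matrix.dotProduct_mulVec, Matrix.vecMul_vecMul,
    ← Matrix.star_eq_conjTranspose, Matrix.mem_unitaryGroup_iff'.1 hU, Matrix.vecMul_one]

theorem transProb_unitary_mulVec {U : M2} (hU : U ∈ Matrix.unitaryGroup (Fin 2) ℂ) (u v : V2) :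
    transProb (U.mulVec u) (U.mulVec v) = transProb u v := by
  simp only [transProb, inner2_unitary_mulVec hU]

/-- Tracing out two unit tensor factors recovers the projector onto the third. -/
theorem mul_star_eq_sum {a b c : V2} (hb : inner2 b b = 1) (hc : inner2 c c = 1) (i k : Fin 2) :
    a i * star (a k) = ∑ p : Fin 2, ∑ q : Fin 2,
      (a i * b p * c q) * star (a k * b p * c q) := by
  simp only [inner2, Fin.sum_univ_two, star_mul'] at *
  linear_combination (-(a i * star (a k))) * hb -
    (a i * star (a k)) * (star (b 0) * b 0 + star (b 1) * b 1) * hc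

theorem transProb_eq_of_mul_star {u v u' v' : V2}
    (hu : ∀ i k, u i * star (u k) = u' i * star (u' k))
    (hv : ∀ i k, v i * star (v k) = v' i * star (v' k)) :
    transProb u v = transProb u' v' := by
  have h (u v : V2) : transProb u v =
      ∑ i, ∑ k, (u i * star (u k)) * (v k * star (v i)) := by
    simp only [transProb, inner2, Fin.sum_univ_two]
    ring
  simp only [h, hu, hv]

/-- Equal products of unit vectors have the same one-party projectors. -/
theorem mul_star_eq_of_tp3_eq {a b c a' b' c' : V2} (ha : inner2 a a = 1) (hb : inner2 b b = 1)
    (hc : inner2 c c = 1) (ha' : inner2 a' a' = 1) (hb' : inner2 b' b' = 1)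
    (hc' : inner2 c' c' = 1) (h : tp3 a b c = tp3 a' b' c') :
    (∀ i k, a i * star (a k) = a' i * star (a' k)) ∧
    (∀ i k, b i * star (b k) = b' i * star (b' k)) ∧
    (∀ i k, c i * star (c k) = c' i * star (c' k)) := by
  have hp (i j k : Fin 2) : a i * b j * c k = a' i * b' j * c' k := congrFun h (i, j, k)
  refine ⟨fun i k => ?_, fun i k => ?_, fun i k => ?_⟩
  · rw [mul_star_eq_sum hb hc, mul_star_eq_sum (a := a') hb' hc']
    simp only [hp]
  · have hq (i j k : Fin 2) : b j * a i * c k = b' j * a' i * c' k := by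
      linear_combination hp i j k
    rw [mul_star_eq_sum ha hc, mul_star_eq_sum (a := b') ha' hc']
    simp only [hq]
  · have hq (i j k : Fin 2) : c k * a i * b j = c' k * a' i * b' j := by
      linear_combination hp i j k
    rw [mul_star_eq_sum ha hb, mul_star_eq_sum (a := c') ha' hb']
    simp only [hq]

/-- Local unitaries and a permutation of members preserve the transition probabilities
of each party. -/
theorem FamEquiv.exists_perm_transProb {a b c a' b' c' : Fin 4 → V2}
    (ha : ∀ j, inner2 (a j) (a j) = 1) (hb : ∀ j, inner2 (b j) (b j) = 1)
    (hc : ∀ j, inner2 (c j) (c j) = 1) (ha' : ∀ j, inner2 (a' j) (a' j) = 1)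
    (hb' : ∀ j, inner2 (b' j) (b' j) = 1) (hc' : ∀ j, inner2 (c' j) (c' j) = 1)
    (h : FamEquiv (fun j => tp3 (a j) (b j) (c j)) (fun j => tp3 (a' j) (b' j) (c' j))) :
    ∃ σ : Equiv.Perm (Fin 4), ∀ i j,
      transProb (a i) (a j) = transProb (a' (σ i)) (a' (σ j)) ∧
      transProb (b i) (b j) = transProb (b' (σ i)) (b' (σ j)) ∧
      transProb (c i) (c j) = transProb (c' (σ i)) (c' (σ j)) := by
  obtain ⟨UA, UB, UC, hUA, hUB, hUC, σ, h⟩ := h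
  have key (j : Fin 4) := mul_star_eq_of_tp3_eq (ha j) (hb j) (hc j)
    ((inner2_unitary_mulVec hUA _ _).trans (ha' (σ j)))
    ((inner2_unitary_mulVec hUB _ _).trans (hb' (σ j)))
    ((inner2_unitary_mulVec hUC _ _).trans (hc' (σ j)))
    ((h j).trans (kron3_mulVec_tp3 _ _ _ _ _ _))
  refine ⟨σ, fun i j => ⟨?_, ?_, ?_⟩⟩
  · rw [transProb_eq_of_mul_star (key i).1 (key j).1, transProb_unitary_mulVec hUA]
  · rw [transProb_eq_of_mul_star (key i).2.1 (key j).2.1, transProb_unitary_mulVec hUB]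
  · rw [transProb_eq_of_mul_star (key i).2.2 (key j).2.2, transProb_unitary_mulVec hUC]

theorem ofReal_sin_sq_add_cos_sq (x : ℝ) :
    ((Real.sin x : ℝ) : ℂ) ^ 2 + ((Real.cos x : ℝ) : ℂ) ^ 2 = 1 := by
  exact_mod_cast Real.sin_sq_add_cos_sq x

theorem inner2_e0_self : inner2 e0 e0 = 1 := by simp [inner2, e0]

theorem inner2_e1_self : inner2 e1 e1 = 1 := by simp [inner2, e1]

theorem inner2_vθ_self (θ : ℝ) : inner2 (vθ θ) (vθ θ) = 1 := by
  simp only [inner2, vθ, Fin.sum_univ_two, Matrix.cons_val_zero, Matrix.cons_val_one,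
    Complex.star_def, Complex.conj_ofReal]
  linear_combination ofReal_sin_sq_add_cos_sq (θ / 2)

/-- A unit vector orthogonal to `vθ θ` is a phase times `(-sin (θ/2), cos (θ/2))`. -/
theorem exists_phase_of_orthogonal {θ : ℝ} {p : V2} (hu : inner2 p p = 1)
    (ho : inner2 (vθ θ) p = 0) :
    ∃ t : ℂ, star t * t = 1 ∧
      p = ![-(t * (Real.sin (θ / 2) : ℝ)), t * (Real.cos (θ / 2) : ℝ)] := by
  have hcs := ofReal_sin_sq_add_cos_sq (θ / 2)
  simp only [inner2, vθ, Fin.sum_univ_two, Matrix.cons_val_zero, Matrix.cons_val_one,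
    Complex.star_def, Complex.conj_ofReal] at hu ho
  generalize Real.sin (θ / 2) = s at *
  generalize Real.cos (θ / 2) = c at *
  obtain ⟨x, y, rfl⟩ : ∃ x y, p = ![x, y] := ⟨p 0, p 1, by ext i; fin_cases i <;> rfl⟩
  simp only [Matrix.cons_val_zero, Matrix.cons_val_one] at hu ho
  refine ⟨c * y - s * x, ?_, ?_⟩
  · simp only [star_sub, star_mul', Complex.star_def, Complex.conj_ofReal] at hu ⊢
    linear_combination (c ^ 2 + s ^ 2 : ℂ) * hu + hcs -
      (c * (starRingEnd ℂ) x + s * (starRingEnd ℂ) y) * ho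
  · ext i
    fin_cases i
    · simp only [Fin.zero_eta, Matrix.cons_val_zero]
      linear_combination c * ho - x * hcs
    · simp only [Fin.mk_one, Matrix.cons_val_one, Matrix.cons_val_fin_one]
      linear_combination s * ho - y * hcs

/-- The vectors `|0⟩, |1⟩, |v⟩, |v^⊥⟩` of one party, grouped into orthogonal pairs. -/
def partyFamily (θ : ℝ) (p : V2) : Fin 4 → V2 := ![e0, e1, vθ θ, p]

theorem inner2_partyFamily_self (θ : ℝ) {p : V2} (hu : inner2 p p = 1) (i : Fin 4) :
    inner2 (partyFamily θ p i) (partyFamily θ p i) = 1 := by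
  fin_cases i
  exacts [inner2_e0_self, inner2_e1_self, inner2_vθ_self θ, hu]

theorem transProb_partyFamily {θ : ℝ} {p : V2} (hu : inner2 p p = 1)
    (ho : inner2 (vθ θ) p = 0) (i j : Fin 4) :
    transProb (partyFamily θ p i) (partyFamily θ p j) =
      !![1, 0, ((Real.cos (θ / 2) : ℝ) : ℂ) ^ 2, ((Real.sin (θ / 2) : ℝ) : ℂ) ^ 2;
         0, 1, ((Real.sin (θ / 2) : ℝ) : ℂ) ^ 2, ((Real.cos (θ / 2) : ℝ) : ℂ) ^ 2;
         ((Real.cos (θ / 2) : ℝ) : ℂ) ^ 2, ((Real.sin (θ / 2) : ℝ) : ℂ) ^ 2, 1, 0;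
         ((Real.sin (θ / 2) : ℝ) : ℂ) ^ 2, ((Real.cos (θ / 2) : ℝ) : ℂ) ^ 2, 0, 1] i j := by
  obtain ⟨t, ht, rfl⟩ := exists_phase_of_orthogonal hu ho
  have hcs := ofReal_sin_sq_add_cos_sq (θ / 2)
  have ht' : (starRingEnd ℂ) t * t = 1 := ht
  simp only [transProb, inner2, partyFamily, e0, e1, vθ, Fin.sum_univ_two]
  fin_cases i <;> fin_cases j <;>
    simp [-Complex.ofReal_cos, -Complex.ofReal_sin] <;>
    generalize ((Real.sin (θ / 2) : ℝ) : ℂ) = s at * <;>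
    generalize ((Real.cos (θ / 2) : ℝ) : ℂ) = c at * <;>
    grind

theorem cos_half_sq_ne_zero {θ : ℝ} (h : θ ∈ Set.Ioo 0 Real.pi) :
    ((Real.cos (θ / 2) : ℝ) : ℂ) ^ 2 ≠ 0 := by
  have := Real.cos_pos_of_mem_Ioo (x := θ / 2) ⟨by linarith [h.1, h.2], by linarith [h.2]⟩
  exact_mod_cast (pow_pos this 2).ne'

theorem sin_half_sq_ne_zero {θ : ℝ} (h : θ ∈ Set.Ioo 0 Real.pi) :
    ((Real.sin (θ / 2) : ℝ) : ℂ) ^ 2 ≠ 0 := by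
  have := Real.sin_pos_of_mem_Ioo (x := θ / 2) ⟨by linarith [h.1], by linarith [h.1, h.2]⟩
  exact_mod_cast (pow_pos this 2).ne'

theorem eq_of_cos_half_sq_eq {θ θ' : ℝ} (h : θ ∈ Set.Ioo 0 Real.pi)
    (h' : θ' ∈ Set.Ioo 0 Real.pi)
    (heq : ((Real.cos (θ / 2) : ℝ) : ℂ) ^ 2 = ((Real.cos (θ' / 2) : ℝ) : ℂ) ^ 2) : θ = θ' := by
  have heq' : Real.cos (θ / 2) ^ 2 = Real.cos (θ' / 2) ^ 2 := by exact_mod_cast heq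
  refine Real.injOn_cos (Set.Ioo_subset_Icc_self h) (Set.Ioo_subset_Icc_self h') ?_
  rw [show θ = 2 * (θ / 2) by ring, show θ' = 2 * (θ' / 2) by ring, Real.cos_two_mul,
    Real.cos_two_mul, heq']


/-- the canonical UPBs for two triples of angles in (0,π) are
equivalent only if the triples coincide. -/
theorem stmt14 (θA θB θC θA' θB' θC' : ℝ)
    (hA : θA ∈ Set.Ioo 0 Real.pi) (hB : θB ∈ Set.Ioo 0 Real.pi)
    (hC : θC ∈ Set.Ioo 0 Real.pi) (hA' : θA' ∈ Set.Ioo 0 Real.pi)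
    (hB' : θB' ∈ Set.Ioo 0 Real.pi) (hC' : θC' ∈ Set.Ioo 0 Real.pi)
    (Ap Bp Cp Ap' Bp' Cp' : V2)
    (hApu : inner2 Ap Ap = 1) (hBpu : inner2 Bp Bp = 1) (hCpu : inner2 Cp Cp = 1)
    (hApu' : inner2 Ap' Ap' = 1) (hBpu' : inner2 Bp' Bp' = 1) (hCpu' : inner2 Cp' Cp' = 1)
    (hApo : inner2 (vθ θA) Ap = 0) (hBpo : inner2 (vθ θB) Bp = 0)
    (hCpo : inner2 (vθ θC) Cp = 0) (hApo' : inner2 (vθ θA') Ap' = 0)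
    (hBpo' : inner2 (vθ θB') Bp' = 0) (hCpo' : inner2 (vθ θC') Cp' = 0)
    (hequiv : FamEquiv
      ![tp3 e0 e0 e0, tp3 e1 (vθ θB) (vθ θC), tp3 (vθ θA) e1 Cp, tp3 Ap Bp e1]
      ![tp3 e0 e0 e0, tp3 e1 (vθ θB') (vθ θC'), tp3 (vθ θA') e1 Cp', tp3 Ap' Bp' e1]) :
    θA = θA' ∧ θB = θB' ∧ θC = θC' := by
  have ha := inner2_partyFamily_self θA hApu
  have hb := inner2_partyFamily_self θB hBpu
  have hc := inner2_partyFamily_self θC hCpu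
  have ha' := inner2_partyFamily_self θA' hApu'
  have hb' := inner2_partyFamily_self θB' hBpu'
  have hc' := inner2_partyFamily_self θC' hCpu'
  have hfam (θA θB θC : ℝ) (Ap Bp Cp : V2) :
      ![tp3 e0 e0 e0, tp3 e1 (vθ θB) (vθ θC), tp3 (vθ θA) e1 Cp, tp3 Ap Bp e1] =
      fun j => tp3 (partyFamily θA Ap j) (partyFamily θB Bp (![0, 2, 1, 3] j))
        (partyFamily θC Cp (![0, 2, 3, 1] j)) := by
    ext j : 1
    fin_cases j <;> rfl
  rw [hfam, hfam] at hequiv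
  obtain ⟨σ, hσ⟩ := hequiv.exists_perm_transProb ha (fun j => hb _) (fun j => hc _)
    ha' (fun j => hb' _) (fun j => hc' _)
  simp only [transProb_partyFamily hApu hApo, transProb_partyFamily hBpu hBpo,
    transProb_partyFamily hCpu hCpo, transProb_partyFamily hApu' hApo',
    transProb_partyFamily hBpu' hBpo', transProb_partyFamily hCpu' hCpo'] at hσ
  have hcA := cos_half_sq_ne_zero hA'
  have hsA := sin_half_sq_ne_zero hA'
  have hcB := cos_half_sq_ne_zero hB'
  have hsB := sin_half_sq_ne_zero hB'
  obtain ⟨h01A, h01B, h01C⟩ := hσ 0 1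
  obtain ⟨h02A, h02B, -⟩ := hσ 0 2
  -- the pair of members orthogonal for `B` determines `θA`; the one orthogonal for `A`
  -- determines `θB` and `θC`
  refine ⟨eq_of_cos_half_sq_eq hA hA' ?_, eq_of_cos_half_sq_eq hB hB' ?_,
    eq_of_cos_half_sq_eq hC hC' ?_⟩
  · clear h01A h01B h01C hσ
    generalize σ 0 = k at *
    generalize σ 2 = l at *
    fin_cases k <;> fin_cases l <;>
      first
      | exact (hcB h02B.symm).elim
      | exact (hsB h02B.symm).elim
      | exact (one_ne_zero (α := ℂ) h02B.symm).elim
      | exact h02A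
  · clear h02A h02B h01C hσ
    generalize σ 0 = k at *
    generalize σ 1 = l at *
    fin_cases k <;> fin_cases l <;>
      first
      | exact (hcA h01A.symm).elim
      | exact (hsA h01A.symm).elim
      | exact (one_ne_zero (α := ℂ) h01A.symm).elim
      | exact h01B
  · clear h02A h02B h01B hσ
    generalize σ 0 = k at *
    generalize σ 1 = l at *
    fin_cases k <;> fin_cases l <;>
      first
      | exact (hcA h01A.symm).elim
      | exact (hsA h01A.symm).elim
      | exact (one_ne_zero (α := ℂ) h01A.symm).elim
      | exact h01C
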